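/- Let ω be a weight map and j an integer with 0 ≤ j < ω(P), and let L := b_j(𝔄_▽(P)) be the image of the set of all antichains of P under the absolute j-blocker map b_j, regarded as a subposet of 𝔄_▽(P). Then: (a) L is closed under the meet of 𝔄_▽(P) (where A' ∧_▽ A'' := min(𝔉(A') ∩ 𝔉(A''))), so L is a sub-meet-semilattice of 𝔄_▽(P) and a lattice; (b) the restriction of b_j to L is an order-reversing bijection of L onto itself, and b_j(b_j(B)) = B for every B ∈ L; in particular, L is a self-dual lattice and b_j restricted to L is an anti-automorphism of L. -/

import Mathlib

open scoped Classical

variable {α : Type*}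

/-- The order ideal generated by a subset `S` of a poset. -/
def idl [PartialOrder α] (S : Set α) : Set α := {p | ∃ s ∈ S, p ≤ s}

/-- The order filter generated by a subset `S` of a poset. -/
def filt [PartialOrder α] (S : Set α) : Set α := {p | ∃ s ∈ S, s ≤ p}

/-- The set of maximal elements of a subposet. -/
def maxOf [PartialOrder α] (S : Set α) : Set α := {x | x ∈ S ∧ ∀ y ∈ S, x ≤ y → x = y}

/-- The set of minimal elements of a subposet. -/
def minOf [PartialOrder α] (S : Set α) : Set α := {x | x ∈ S ∧ ∀ y ∈ S, y ≤ x → x = y}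

/-- The meet `A ∧_▵ B := max (𝔍(A) ∩ 𝔍(B))` of antichains in `𝔄_▵(P)`. -/
def meetT [PartialOrder α] (A B : Set α) : Set α := maxOf (idl A ∩ idl B)

/-- A weight map `ω` on antichains of `P`: `ω(∅) = -1`, `ω({⊥}) = 0`, and
`0 < ω(A') ≤ ω(A'')` whenever `{⊥} < A' ≤ A''` in `𝔄_▵(P)`. -/
structure WeightMap (α : Type*) [PartialOrder α] [OrderBot α] where
  w : Set α → ℤ
  w_empty : w (∅ : Set α) = -1
  w_bot : w ({⊥} : Set α) = 0
  w_pos_mono : ∀ A' A'' : Set α, IsAntichain (· ≤ ·) A' → IsAntichain (· ≤ ·) A'' →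
    idl ({⊥} : Set α) ⊂ idl A' → idl A' ⊆ idl A'' → 0 < w A' ∧ w A' ≤ w A''

/-- The subposet `I_r(P,A;ω)` of relatively `r`-blocking elements for `A` in `P`. -/
noncomputable def relBlock [PartialOrder α] [OrderBot α] (ω : WeightMap α) (r : ℚ)
    (A : Set α) : Set α :=
  if A = ∅ then Set.univ
  else if A = ({⊥} : Set α) then ∅
  else {b | b ≠ ⊥ ∧ ∀ a ∈ A \ {⊥}, r < (ω.w (meetT {b} {a}) : ℚ) / (ω.w {b} : ℚ)}

/-- The absolute `j`-blocker map `b_j` on antichains: a nontrivial antichain `A` is sent to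
`min {b ∈ P : ω({b} ∧_▵ {a}) > j for all a ∈ A}`, and `∅ ↦ {⊥}`, `{⊥} ↦ ∅`. -/
noncomputable def bj [PartialOrder α] [OrderBot α] (ω : WeightMap α) (j : ℤ)
    (A : Set α) : Set α :=
  if A = ∅ then ({⊥} : Set α)
  else if A = ({⊥} : Set α) then ∅
  else minOf {b | ∀ a ∈ A, j < ω.w (meetT {b} {a})}

theorem minOf_isAntichain [PartialOrder α] (S : Set α) : IsAntichain (· ≤ ·) (minOf S) :=
  fun _ hx _ hy hne hle => hne (hy.2 _ hx.1 hle).symm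

theorem maxOf_isAntichain [PartialOrder α] (S : Set α) : IsAntichain (· ≤ ·) (maxOf S) :=
  fun _ hx _ hy hne hle => hne (hx.2 _ hy.1 hle)

theorem exists_minOf_le [Finite α] [PartialOrder α] {S : Set α} {x : α} (hx : x ∈ S) :
    ∃ m ∈ minOf S, m ≤ x := by
  obtain ⟨m, hmx, hm⟩ := S.toFinite.exists_le_minimal hx
  exact ⟨m, ⟨hm.1, fun y hy hym => le_antisymm (hm.2 hy hym) hym⟩, hmx⟩

theorem exists_le_maxOf [Finite α] [PartialOrder α] {S : Set α} {x : α} (hx : x ∈ S) :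
    ∃ m ∈ maxOf S, x ≤ m := by
  obtain ⟨m, hxm, hm⟩ := S.toFinite.exists_le_maximal hx
  exact ⟨m, ⟨hm.1, fun y hy hmy => le_antisymm hmy (hm.2 hy hmy)⟩, hxm⟩

theorem filt_minOf [Finite α] [PartialOrder α] {S : Set α} (hS : IsUpperSet S) :
    filt (minOf S) = S := by
  ext x
  exact ⟨fun ⟨s, hs, hsx⟩ => hS hsx hs.1, fun hx => exists_minOf_le hx⟩

theorem idl_singleton [PartialOrder α] (a : α) : idl {a} = Set.Iic a := by
  ext x
  simp [idl]

theorem idl_meetT_singleton [Finite α] [PartialOrder α] (a b : α) :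
    idl (meetT {b} {a}) = Set.Iic b ∩ Set.Iic a := by
  simp only [meetT, idl_singleton]
  ext x
  exact ⟨fun ⟨s, hs, hxs⟩ => ⟨hxs.trans hs.1.1, hxs.trans hs.1.2⟩, fun hx => exists_le_maxOf hx⟩

theorem meetT_comm [PartialOrder α] (A B : Set α) : meetT A B = meetT B A := by
  simp only [meetT, Set.inter_comm]

theorem meetT_singleton_bot [PartialOrder α] [OrderBot α] (b : α) :
    meetT {b} {(⊥ : α)} = {⊥} := by
  ext x
  simp +contextual [meetT, idl_singleton, maxOf]

/-- If the meet of `b` and `a` has positive weight, enlarging `b` does not decrease the weight. -/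
theorem WeightMap.w_meetT_le [Finite α] [PartialOrder α] [OrderBot α] (ω : WeightMap α)
    {a b b' : α} (hbb' : b ≤ b') (hpos : 0 < ω.w (meetT {b} {a})) :
    ω.w (meetT {b} {a}) ≤ ω.w (meetT {b'} {a}) := by
  refine (ω.w_pos_mono (meetT {b} {a}) (meetT {b'} {a}) (maxOf_isAntichain _)
    (maxOf_isAntichain _) ?_ ?_).2
  · rw [idl_meetT_singleton, idl_singleton, Set.Iic_bot]
    refine (Set.ssubset_iff_subset_ne).2 ⟨by simp, fun h => hpos.ne' ?_⟩
    have hmeet : meetT {b} {a} = {(⊥ : α)} := by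
      simp only [meetT, idl_singleton, ← h]
      ext x
      simp +contextual [maxOf]
    rw [hmeet, ω.w_bot]
  · simp only [idl_meetT_singleton]
    exact Set.inter_subset_inter_left _ (Set.Iic_subset_Iic.2 hbb')

/-- The elements `b` such that the meet of `b` with every `a ∈ A` has weight greater than `j`. -/
def blocking [PartialOrder α] [OrderBot α] (ω : WeightMap α) (j : ℤ) (A : Set α) : Set α :=
  {b | ∀ a ∈ A, j < ω.w (meetT {b} {a})}

section Blocking

variable [PartialOrder α] [OrderBot α] (ω : WeightMap α) {j : ℤ}

theorem blocking_anti {A B : Set α} (h : A ⊆ B) : blocking ω j B ⊆ blocking ω j A :=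
  fun _ hb a ha => hb a (h ha)

theorem blocking_union (A B : Set α) :
    blocking ω j (A ∪ B) = blocking ω j A ∩ blocking ω j B := by
  ext b
  simp [blocking, or_imp, forall_and]

theorem subset_blocking_blocking (A : Set α) : A ⊆ blocking ω j (blocking ω j A) :=
  fun a ha b hb => meetT_comm {b} {a} ▸ hb a ha

theorem blocking_blocking_blocking (A : Set α) :
    blocking ω j (blocking ω j (blocking ω j A)) = blocking ω j A :=
  (blocking_anti ω (subset_blocking_blocking ω A)).antisymm (subset_blocking_blocking ω _)

theorem bj_eq_minOf_blocking (hj0 : 0 ≤ j) (A : Set α) : bj ω j A = minOf (blocking ω j A) := by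
  unfold bj
  split_ifs with h h'
  · subst h
    ext x
    simp only [minOf, blocking, Set.mem_singleton_iff, Set.mem_ofPred_eq, Set.mem_empty_iff_false,
      false_imp_iff, implies_true, true_and, true_imp_iff]
    constructor
    · rintro rfl y hy
      exact (le_bot_iff.1 hy).symm
    · exact fun h => h ⊥ bot_le
  · subst h'
    have hempty : blocking ω j {(⊥ : α)} = ∅ := by
      ext b
      simp [blocking, meetT_singleton_bot, ω.w_bot, hj0]
    simp [hempty, minOf]
  · rfl

theorem bj_isAntichain (hj0 : 0 ≤ j) (A : Set α) : IsAntichain (· ≤ ·) (bj ω j A) := by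
  rw [bj_eq_minOf_blocking ω hj0]
  exact minOf_isAntichain _

variable [Finite α]

theorem isUpperSet_blocking (hj0 : 0 ≤ j) (A : Set α) : IsUpperSet (blocking ω j A) :=
  fun _ _ hbb' hb a ha => (hb a ha).trans_le (ω.w_meetT_le hbb' (hj0.trans_lt (hb a ha)))

theorem blocking_filt (hj0 : 0 ≤ j) (A : Set α) : blocking ω j (filt A) = blocking ω j A := by
  refine Set.Subset.antisymm (blocking_anti ω fun a ha => ⟨a, ha, le_rfl⟩) ?_
  rintro b hb x ⟨a, ha, hax⟩
  have h := hb a ha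
  rw [meetT_comm] at h ⊢
  exact h.trans_le (ω.w_meetT_le hax (hj0.trans_lt h))

theorem blocking_minOf (hj0 : 0 ≤ j) (A : Set α) : blocking ω j (minOf A) = blocking ω j A := by
  refine Set.Subset.antisymm ?_ (blocking_anti ω fun a ha => ha.1)
  rw [← blocking_filt ω hj0 (minOf A)]
  exact blocking_anti ω fun x (hx : x ∈ A) => exists_minOf_le hx

theorem filt_bj (hj0 : 0 ≤ j) (A : Set α) : filt (bj ω j A) = blocking ω j A := by
  rw [bj_eq_minOf_blocking ω hj0, filt_minOf (isUpperSet_blocking ω hj0 A)]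

theorem bj_bj_bj (hj0 : 0 ≤ j) (A : Set α) : bj ω j (bj ω j (bj ω j A)) = bj ω j A := by
  simp only [bj_eq_minOf_blocking ω hj0, blocking_minOf ω hj0, blocking_blocking_blocking]

end Blocking

/-- The image `L = b_j(𝔄_▽(P))` is a sub-meet-semilattice of `𝔄_▽(P)` (closed under
`A' ∧_▽ A'' = min(𝔉(A') ∩ 𝔉(A''))`), and the restriction of `b_j` to `L` is an
order-reversing bijection of `L` onto itself satisfying `b_j(b_j(B)) = B` on `L`. -/
theorem stmt_6 [Fintype α] [PartialOrder α] [BoundedOrder α] [Nontrivial α]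
    (ω : WeightMap α) (j : ℤ) (hj0 : 0 ≤ j) (hj : j < ω.w ({⊤} : Set α))
    (L : Set (Set α)) (hL : L = bj ω j '' {A : Set α | IsAntichain (· ≤ ·) A}) :
    (∀ B ∈ L, ∀ B' ∈ L, minOf (filt B ∩ filt B') ∈ L) ∧
    (∀ B ∈ L, bj ω j B ∈ L) ∧
    (∀ B ∈ L, ∀ B' ∈ L, filt B ⊆ filt B' → filt (bj ω j B') ⊆ filt (bj ω j B)) ∧
    (∀ B ∈ L, bj ω j (bj ω j B) = B) ∧
    Set.BijOn (bj ω j) L L := by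
  subst hL
  have hmaps : ∀ B ∈ bj ω j '' {A : Set α | IsAntichain (· ≤ ·) A},
      bj ω j B ∈ bj ω j '' {A : Set α | IsAntichain (· ≤ ·) A} := by
    rintro _ ⟨A, -, rfl⟩
    exact ⟨_, bj_isAntichain ω hj0 A, rfl⟩
  have hinv : ∀ B ∈ bj ω j '' {A : Set α | IsAntichain (· ≤ ·) A},
      bj ω j (bj ω j B) = B := by
    rintro _ ⟨A, -, rfl⟩
    exact bj_bj_bj ω hj0 A
  refine ⟨?_, hmaps, ?_, hinv, Set.InvOn.bijOn ⟨hinv, hinv⟩ hmaps hmaps⟩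
  · rintro _ ⟨A, -, rfl⟩ _ ⟨A', -, rfl⟩
    refine ⟨minOf (A ∪ A'), minOf_isAntichain _, ?_⟩
    rw [filt_bj ω hj0, filt_bj ω hj0, ← blocking_union, bj_eq_minOf_blocking ω hj0,
      blocking_minOf ω hj0]
  · intro B _ B' _ h
    rw [filt_bj ω hj0, filt_bj ω hj0, ← blocking_filt ω hj0 B, ← blocking_filt ω hj0 B']
    exact blocking_anti ω h
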